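/- Let (X_n)_{n≥1} be a sequence of non-negative integrable random variables and let (a_n)_{n≥1} be a non-decreasing unbounded sequence of positive real numbers. Set G(x) = sup_{n≥1} (1/a_n) ∑_{k=1}^{n} P(X_k > x) for x ≥ 0 and suppose ∫_0^∞ G(x) dx < ∞. Let Y_n = X_n · 1_{{X_n ≤ a_n}}. Then sup_{n≥1} (1/a_n) ∑_{k=1}^{n} E Y_k ≤ ∫_0^∞ G(x) dx < ∞. -/

import Mathlib

open MeasureTheory ProbabilityTheory Filter ENNReal

/-- The mean of a truncation is at most the integral of the tail of the untruncated variable. -/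
theorem ofReal_integral_indicator_le_lintegral_meas_lt {Ω : Type*} [MeasurableSpace Ω]
    {μ : Measure Ω} {f : Ω → ℝ} (hf : Integrable f μ) (hf0 : 0 ≤ f) (s : Set Ω) :
    ENNReal.ofReal (∫ ω, s.indicator f ω ∂μ) ≤ ∫⁻ x in Set.Ioi (0 : ℝ), μ {ω | x < f ω} := by
  rw [← lintegral_eq_lintegral_meas_lt μ (ae_of_all _ hf0) hf.aemeasurable,
    ← ofReal_integral_eq_lintegral_ofReal hf (ae_of_all _ hf0)]
  refine ENNReal.ofReal_le_ofReal (integral_mono_of_nonneg (ae_of_all _ fun ω => ?_) hf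
    (ae_of_all _ fun ω => ?_))
  · exact Set.indicator_nonneg (fun ω _ => hf0 ω) ω
  · exact Set.indicator_le_self' (fun ω _ => hf0 ω) ω

/-- The tail function of a real function is measurable. -/
theorem measurable_meas_lt {Ω : Type*} [MeasurableSpace Ω] (μ : Measure Ω) (f : Ω → ℝ) :
    Measurable fun x : ℝ => μ {ω | x < f ω} :=
  Antitone.measurable fun _ _ hxy => measure_mono fun _ hω => lt_of_le_of_lt hxy hω

/-- Step (3.14) of the proof of Theorem 1: for non-negative integrable random variables with
`G x = sup_{n≥1} (1/a_n) ∑_{k=1}^n P(X_k > x)` satisfying `∫_0^∞ G < ∞`, the truncations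
`Y_n = X_n · 1_{X_n ≤ a_n}` satisfy `sup_{n≥1} (1/a_n) ∑_{k=1}^n E Y_k ≤ ∫_0^∞ G < ∞`. -/
theorem truncated_means_bounded {Ω : Type*} [MeasurableSpace Ω] (μ : Measure Ω)
    [IsProbabilityMeasure μ]
    (X : ℕ → Ω → ℝ) (hmeas : ∀ n, Measurable (X n))
    (hnonneg : ∀ n ω, 0 ≤ X n ω)
    (hint : ∀ n, 1 ≤ n → Integrable (X n) μ)
    (a : ℕ → ℝ) (ha_pos : ∀ n, 0 < a n) (ha_mono : Monotone a)
    (ha_unbdd : Tendsto a atTop atTop)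
    (hG : (∫⁻ x in Set.Ioi (0 : ℝ), ⨆ n, ⨆ (_ : 1 ≤ n),
        (∑ k ∈ Finset.Icc 1 n, μ {ω | x < X k ω}) / ENNReal.ofReal (a n)) < ⊤) :
    ∀ n, 1 ≤ n →
      (∑ k ∈ Finset.Icc 1 n, ∫ ω, ({ω' | X k ω' ≤ a k}.indicator (X k)) ω ∂μ) / a n
        ≤ (∫⁻ x in Set.Ioi (0 : ℝ), ⨆ m, ⨆ (_ : 1 ≤ m),
            (∑ k ∈ Finset.Icc 1 m, μ {ω | x < X k ω}) / ENNReal.ofReal (a m)).toReal := by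
  intro n hn
  rw [← ENNReal.ofReal_le_iff_le_toReal hG.ne, ENNReal.ofReal_div_of_pos (ha_pos n),
    ENNReal.ofReal_sum_of_nonneg fun k _ =>
      integral_nonneg fun ω => Set.indicator_nonneg (fun ω _ => hnonneg k ω) ω]
  calc
    _ ≤ (∑ k ∈ Finset.Icc 1 n, ∫⁻ x in Set.Ioi (0 : ℝ), μ {ω | x < X k ω}) /
          ENNReal.ofReal (a n) := by
        gcongr with k hk
        exact ofReal_integral_indicator_le_lintegral_meas_lt
          (hint k (Finset.mem_Icc.1 hk).1) (hnonneg k) _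
    _ = ∫⁻ x in Set.Ioi (0 : ℝ), (∑ k ∈ Finset.Icc 1 n, μ {ω | x < X k ω}) /
          ENNReal.ofReal (a n) := by
        simp only [div_eq_mul_inv]
        rw [lintegral_mul_const _ (Finset.measurable_fun_sum _ fun k _ => measurable_meas_lt μ (X k)),
          lintegral_finsetSum _ fun k _ => measurable_meas_lt μ (X k)]
    _ ≤ _ := lintegral_mono fun x => le_iSup₂_of_le n hn le_rfl
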